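/- S-equivalence is an equivalence relation on Diff₀(V): it is reflexive, symmetric, and transitive. (Implicit in Proposition 1.9 and the group structure on S-equivalence classes in Proposition 1.11 of the paper.) -/

import Mathlib

open scoped Manifold
open Metric Set Module

noncomputable section

/-- The 3-sphere: unit sphere in `EuclideanSpace ℝ (Fin 4)`. -/
abbrev S3 : Type := Metric.sphere (0 : EuclideanSpace ℝ (Fin 4)) 1

/-- The 4-sphere: unit sphere in `EuclideanSpace ℝ (Fin 5)`. -/
abbrev S4 : Type := Metric.sphere (0 : EuclideanSpace ℝ (Fin 5)) 1

instance : Fact (Module.finrank ℝ (EuclideanSpace ℝ (Fin 4)) = 3 + 1) :=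
  ⟨finrank_euclideanSpace_fin⟩
instance : Fact (Module.finrank ℝ (EuclideanSpace ℝ (Fin 5)) = 4 + 1) :=
  ⟨finrank_euclideanSpace_fin⟩

/-- A `C^∞` diffeomorphism between two smooth manifolds, as a predicate on maps. -/
def IsDiffeoB {E H M E' H' M' : Type*} [NormedAddCommGroup E] [NormedSpace ℝ E]
    [TopologicalSpace H] [NormedAddCommGroup E'] [NormedSpace ℝ E'] [TopologicalSpace H']
    (I : ModelWithCorners ℝ E H) (I' : ModelWithCorners ℝ E' H')
    [TopologicalSpace M] [ChartedSpace H M] [TopologicalSpace M'] [ChartedSpace H' M']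
    (f : M → M') : Prop :=
  ContMDiff I I' (⊤ : ℕ∞) f ∧ ∃ g : M' → M, ContMDiff I' I (⊤ : ℕ∞) g ∧
    Function.LeftInverse g f ∧ Function.RightInverse g f

/-- A smooth ambient isotopy of a manifold `M`: a family `F : ℝ → M → M` with `F 0 = id`,
each `F t` a bijection, and both `(t, x) ↦ F t x` and the family of inverses jointly `C^∞`. -/
def IsAmbientIsotopy {E H M : Type*} [NormedAddCommGroup E] [NormedSpace ℝ E]
    [TopologicalSpace H] (I : ModelWithCorners ℝ E H)
    [TopologicalSpace M] [ChartedSpace H M]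
    (F : ℝ → M → M) : Prop :=
  F 0 = id ∧ (∀ t, Function.Bijective (F t)) ∧
  ContMDiff (𝓘(ℝ, ℝ).prod I) I (⊤ : ℕ∞) (fun q : ℝ × M => F q.1 q.2) ∧
  ∃ G : ℝ → M → M, (∀ t, Function.LeftInverse (G t) (F t) ∧ Function.RightInverse (G t) (F t)) ∧
    ContMDiff (𝓘(ℝ, ℝ).prod I) I (⊤ : ℕ∞) (fun q : ℝ × M => G q.1 q.2)

/-- Two subsets of a smooth manifold are smoothly ambiently isotopic. -/
def AmbIsotopic {E H M : Type*} [NormedAddCommGroup E] [NormedSpace ℝ E]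
    [TopologicalSpace H] (I : ModelWithCorners ℝ E H)
    [TopologicalSpace M] [ChartedSpace H M]
    (A B : Set M) : Prop :=
  ∃ F : ℝ → M → M, IsAmbientIsotopy I F ∧ (F 1) '' A = B

/-- A smooth embedding of the 3-sphere into a smooth manifold: `C^∞`, injective, a topological
embedding, and an immersion. -/
def IsS3Embedding {E H M : Type*} [NormedAddCommGroup E] [NormedSpace ℝ E]
    [TopologicalSpace H] (I : ModelWithCorners ℝ E H)
    [TopologicalSpace M] [ChartedSpace H M]
    (f : S3 → M) : Prop :=
  ContMDiff (𝓡 3) I (⊤ : ℕ∞) f ∧ Function.Injective f ∧ Topology.IsEmbedding f ∧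
    ∀ x : S3, Function.Injective (mfderiv (𝓡 3) I f x)

/-- The 4-manifold `V = S¹ × S³`. -/
abbrev V : Type := Circle × S3

/-- The model for `V`. -/
abbrev IV := (𝓡 1).prod (𝓡 3)

/-- The model for `ℝ × S³`. -/
abbrev IRS := 𝓘(ℝ, ℝ).prod (𝓡 3)

/-- The universal covering `ℝ × S³ → V`, `(t, w) ↦ (exp t, w)`. -/
def pcov : ℝ × S3 → V := fun q => (Circle.exp q.1, q.2)

/-- The `n`-fold covering `V → V`, `(z, w) ↦ (zⁿ, w)`. -/
def pcovN (n : ℕ) : V → V := fun q => (q.1 ^ n, q.2)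

/-- Membership in `Diff₀(V)`: a diffeomorphism of `V` homotopic to the identity. -/
def InDiff0 (φ : V → V) : Prop :=
  IsDiffeoB IV IV φ ∧ ∃ hc : Continuous φ,
    ContinuousMap.Homotopic ⟨φ, hc⟩ (ContinuousMap.id V)

/-- A lift of `φ : V → V` to the `n`-fold cover. -/
def IsLiftN (n : ℕ) (φ φh : V → V) : Prop :=
  IsDiffeoB IV IV φh ∧ ∀ q : V, pcovN n (φh q) = φ (pcovN n q)

/-- A lift of `φ : V → V` to the universal cover `ℝ × S³`. -/
def IsLiftU (φ : V → V) (φt : ℝ × S3 → ℝ × S3) : Prop :=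
  IsDiffeoB IRS IRS φt ∧ ∀ q : ℝ × S3, pcov (φt q) = φ (pcov q)

/-- S-equivalence of elements of `Diff₀(V)`. -/
def SEquiv (φ ψ : V → V) : Prop :=
  ∃ n : ℕ, 1 ≤ n ∧ ∃ φh ψh : V → V, IsLiftN n φ φh ∧ IsLiftN n ψ ψh ∧
    ∃ z₀ : Circle,
      AmbIsotopic IV (φh '' (({z₀} : Set Circle) ×ˢ (Set.univ : Set S3)))
        (ψh '' (({z₀} : Set Circle) ×ˢ (Set.univ : Set S3)))

/-- `φ` interpolates to `ψ`: some lift of `φ` can be glued to some lift of `ψ` by a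
diffeomorphism of `ℝ × S³` agreeing with the first near `-∞` and the second near `+∞`. -/
def Interpolates (φ ψ : V → V) : Prop :=
  ∃ φt ψt h : ℝ × S3 → ℝ × S3, IsLiftU φ φt ∧ IsLiftU ψ ψt ∧
    IsDiffeoB IRS IRS h ∧ ∃ a b : ℝ, a ≤ b ∧
      (∀ q : ℝ × S3, q.1 ≤ a → h q = φt q) ∧
      (∀ q : ℝ × S3, b ≤ q.1 → h q = ψt q)

open scoped ContDiff

/-- The slice `{z} × S³` of `V`. -/
abbrev slice (z : Circle) : Set V := ({z} : Set Circle) ×ˢ (Set.univ : Set S3)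

/-- The rotation of the circle factor of `V` by `c`. -/
def rot (c : Circle) : V → V := fun q => (c * q.1, q.2)

instance connectedSpace_S3 : ConnectedSpace S3 :=
  isConnected_iff_connectedSpace.1 <| isConnected_sphere
    (by rw [← Module.finrank_eq_rank, finrank_euclideanSpace_fin]; norm_num) 0 zero_le_one

/-! ### Lifting circle-valued maps along the exponential -/

/-- A null-homotopic circle-valued map has a continuous real lift. -/
theorem exists_lift_circleExp {A : Type*} [TopologicalSpace A] {g : C(A, Circle)}
    (h : (ContinuousMap.const A 1).Homotopic g) : ∃ u : C(A, ℝ), ∀ a, Circle.exp (u a) = g a := by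
  obtain ⟨H⟩ := h
  have H0 : ∀ a, H.toContinuousMap (0, a) = Circle.exp (ContinuousMap.const A (0 : ℝ) a) :=
    fun a => by simp
  let L := Circle.isCoveringMap_exp.liftHomotopy H.toContinuousMap (.const A 0) H0
  refine ⟨L.comp ⟨fun a => (1, a), by fun_prop⟩, fun a => ?_⟩
  exact (congr_fun (Circle.isCoveringMap_exp.liftHomotopy_lifts _ _ H0) (1, a)).trans
    (H.apply_one a)

theorem contMDiffAt_circle_arg {z : Circle} (hz : (z : ℂ) ∈ Complex.slitPlane) :
    ContMDiffAt (𝓡 1) 𝓘(ℝ, ℝ) ∞ (fun z : Circle => Complex.arg z) z := by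
  have h1 : ContDiffAt ℝ ∞ (fun w : ℂ => (Complex.log w).im) z :=
    Complex.imCLM.contDiff.contDiffAt.comp _ ((Complex.contDiffAt_log hz).restrict_scalars ℝ)
  simp only [Complex.log_im] at h1
  have := finrank_real_complex_fact'
  have h2 : ContMDiff (𝓡 1) 𝓘(ℝ, ℂ) ∞ (fun z : Circle => (z : ℂ)) := contMDiff_coe_sphere
  exact ContMDiffAt.comp z h1.contMDiffAt h2.contMDiffAt

section Manifold

variable {E H M : Type*} [NormedAddCommGroup E] [NormedSpace ℝ E]
    [TopologicalSpace H] {I : ModelWithCorners ℝ E H} [TopologicalSpace M] [ChartedSpace H M]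

/-- A continuous real lift of a smooth circle-valued map is smooth. -/
theorem ContMDiff.of_circleExp {u : M → ℝ} (hu : Continuous u)
    (h : ContMDiff I (𝓡 1) ∞ fun x => Circle.exp (u x)) : ContMDiff I 𝓘(ℝ, ℝ) ∞ u := by
  intro x
  have hq : ContMDiff I (𝓡 1) ∞ fun y => Circle.exp (u y) / Circle.exp (u x) :=
    h.div contMDiff_const
  have h1 : ContMDiffAt I 𝓘(ℝ, ℝ) ∞
      (fun y => Complex.arg ((Circle.exp (u y) / Circle.exp (u x) : Circle) : ℂ)) x :=
    ContMDiffAt.comp x (contMDiffAt_circle_arg (by simp)) hq.contMDiffAt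
  have h2 : ContMDiffAt I 𝓘(ℝ, ℝ) ∞
      (fun y => Complex.arg ((Circle.exp (u y) / Circle.exp (u x) : Circle) : ℂ) + u x) x :=
    h1.add contMDiffAt_const
  refine h2.congr_of_eventuallyEq ?_
  have hev : ∀ᶠ y in nhds x, |u y - u x| < Real.pi :=
    (show Continuous fun y => |u y - u x| by fun_prop).continuousAt.eventually_lt
      continuousAt_const (by simpa using Real.pi_pos)
  filter_upwards [hev] with y hy
  rw [abs_lt] at hy
  rw [← Circle.exp_sub, Circle.arg_exp hy.1 hy.2.le]
  ring

end Manifold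

/-! ### Roots of unity and uniqueness of lifts -/

theorem finite_pow_eq_one {m : ℕ} (hm : 1 ≤ m) : {c : Circle | c ^ m = 1}.Finite := by
  have hf : {z : ℂ | z ^ m = 1}.Finite := by
    refine (Polynomial.nthRoots m (1 : ℂ)).toFinset.finite_toSet.subset fun z hz => ?_
    simpa [Polynomial.mem_nthRoots hm] using hz
  refine (hf.preimage (f := ((↑) : Circle → ℂ)) Circle.coe_injective.injOn).subset fun c hc => ?_
  have : ((c ^ m : Circle) : ℂ) = 1 := by rw [show c ^ m = 1 from hc]; rfl
  simpa using this

theorem eq_of_pow_eq_one {X : Type*} [TopologicalSpace X] [PreconnectedSpace X] {m : ℕ}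
    (hm : 1 ≤ m) {c : X → Circle} (hc : Continuous c) (h : ∀ x, c x ^ m = 1) (x y : X) :
    c x = c y :=
  isPreconnected_univ.constant_of_mapsTo (finite_pow_eq_one hm).isDiscrete hc.continuousOn
    (fun x _ => h x) (mem_univ x) (mem_univ y)

/-- Two continuous maps into `V` with the same projection under `pcovN m` differ by a deck
transformation. -/
theorem eq_rot_of_pcovN_eq {X : Type*} [TopologicalSpace X] [PreconnectedSpace X] {m : ℕ}
    (hm : 1 ≤ m) {f g : X → V} (hf : Continuous f) (hg : Continuous g)
    (h : ∀ x, pcovN m (f x) = pcovN m (g x)) (x₀ : X) :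
    ∃ c : Circle, c ^ m = 1 ∧ c = (f x₀).1 / (g x₀).1 ∧ ∀ x, f x = rot c (g x) := by
  have hpow : ∀ x, ((f x).1 / (g x).1) ^ m = 1 := fun x => by
    rw [div_pow, div_eq_one]; exact congrArg Prod.fst (h x)
  refine ⟨_, hpow x₀, rfl, fun x => Prod.ext ?_ (congrArg Prod.snd (h x) :)⟩
  rw [eq_of_pow_eq_one hm (c := fun x => (f x).1 / (g x).1) (by fun_prop) hpow x₀ x]
  simp [rot]

theorem pcovN_one (q : V) : pcovN 1 q = q := by simp [pcovN]

theorem pcovN_pcovN (n m : ℕ) (q : V) : pcovN n (pcovN m q) = pcovN (n * m) q := by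
  simp [pcovN, ← pow_mul, mul_comm]

theorem pcovN_rot {m : ℕ} {c : Circle} (hc : c ^ m = 1) (q : V) :
    pcovN m (rot c q) = pcovN m q := by
  simp [pcovN, rot, mul_pow, hc]

theorem exists_circle_pow_eq {m : ℕ} (hm : 1 ≤ m) (z : Circle) : ∃ w : Circle, w ^ m = z := by
  obtain ⟨t, rfl⟩ := Circle.exp_surjective z
  refine ⟨Circle.exp (t / m), ?_⟩
  rw [← Circle.exp_nsmul, nsmul_eq_mul, mul_div_cancel₀]
  positivity

theorem rot_image_slice (c z : Circle) : rot c '' slice z = slice (c * z) := by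
  ext q
  constructor
  · rintro ⟨p, ⟨hp, -⟩, rfl⟩
    exact ⟨by rw [mem_singleton_iff] at hp ⊢; rw [← hp]; rfl, mem_univ _⟩
  · rintro ⟨hq, -⟩
    exact ⟨(z, q.2), by simp, Prod.ext hq.symm rfl⟩

/-! ### Ambient isotopies -/

section Isotopy

variable {E H M : Type*} [NormedAddCommGroup E] [NormedSpace ℝ E]
    [TopologicalSpace H] {I : ModelWithCorners ℝ E H} [TopologicalSpace M] [ChartedSpace H M]
    {A B C : Set M}

theorem IsAmbientIsotopy.of_inverse {F G : ℝ → M → M} (h0 : F 0 = id)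
    (hF : ContMDiff (𝓘(ℝ, ℝ).prod I) I ∞ (fun q : ℝ × M => F q.1 q.2))
    (hG : ContMDiff (𝓘(ℝ, ℝ).prod I) I ∞ (fun q : ℝ × M => G q.1 q.2))
    (h1 : ∀ t q, G t (F t q) = q) (h2 : ∀ t q, F t (G t q) = q) : IsAmbientIsotopy I F :=
  ⟨h0, fun t => ⟨Function.LeftInverse.injective (h1 t),
    Function.RightInverse.surjective (h2 t)⟩, hF, G, fun t => ⟨h1 t, h2 t⟩, hG⟩

theorem AmbIsotopic.refl (A : Set M) : AmbIsotopic I A A :=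
  ⟨fun _ => id, .of_inverse (G := fun _ => id) rfl contMDiff_snd contMDiff_snd
    (fun _ _ => rfl) (fun _ _ => rfl), image_id A⟩

theorem AmbIsotopic.symm (h : AmbIsotopic I A B) : AmbIsotopic I B A := by
  obtain ⟨F, ⟨h0, -, hF, G, hFG, hG⟩, rfl⟩ := h
  refine ⟨G, .of_inverse ?_ hG hF (fun t => (hFG t).2) (fun t => (hFG t).1), ?_⟩
  · funext q
    simpa [h0] using (hFG 0).1 q
  · rw [(hFG 1).1.image_image]

theorem AmbIsotopic.trans (h : AmbIsotopic I A B) (h' : AmbIsotopic I B C) :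
    AmbIsotopic I A C := by
  obtain ⟨F, ⟨h0, -, hF, G, hFG, hG⟩, rfl⟩ := h
  obtain ⟨F', ⟨h0', -, hF', G', hFG', hG'⟩, rfl⟩ := h'
  refine ⟨fun t q => F' t (F t q), .of_inverse (G := fun t q => G t (G' t q)) ?_
    (hF'.comp (contMDiff_fst.prodMk hF)) (hG.comp (contMDiff_fst.prodMk hG')) ?_ ?_, ?_⟩
  · funext q; simp [h0, h0']
  · intro t q; rw [(hFG' t).1, (hFG t).1]
  · intro t q; rw [(hFG t).2, (hFG' t).2]
  · rw [image_image]

/-- Diffeomorphisms preserve ambient isotopy. -/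
theorem AmbIsotopic.image {f : M → M} (h : AmbIsotopic I A B) (hf : IsDiffeoB I I f) :
    AmbIsotopic I (f '' A) (f '' B) := by
  obtain ⟨F, ⟨h0, -, hF, G, hFG, hG⟩, rfl⟩ := h
  obtain ⟨hfs, g, hgs, hgf, hfg⟩ := hf
  refine ⟨fun t q => f (F t (g q)), .of_inverse (G := fun t q => f (G t (g q))) ?_
    (hfs.comp (hF.comp (contMDiff_fst.prodMk (hgs.comp contMDiff_snd))))
    (hfs.comp (hG.comp (contMDiff_fst.prodMk (hgs.comp contMDiff_snd)))) ?_ ?_, ?_⟩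
  · funext q; simp [h0, hfg q]
  · intro t q; rw [hgf, (hFG t).1, hfg]
  · intro t q; rw [hgf, (hFG t).2, hfg]
  · simp only [image_image, hgf _]

end Isotopy

theorem contMDiff_rot_exp (a : ℝ) : ContMDiff (𝓘(ℝ, ℝ).prod IV) IV ∞
    (fun q : ℝ × V => rot (Circle.exp (q.1 * a)) q.2) := by
  have h1 : ContMDiff (𝓘(ℝ, ℝ).prod IV) 𝓘(ℝ, ℝ) ∞ (fun q : ℝ × V => q.1 * a) :=
    contMDiff_fst.mul contMDiff_const
  exact ((contMDiff_circleExp.comp h1).mul (contMDiff_fst.comp contMDiff_snd)).prodMk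
    (contMDiff_snd.comp contMDiff_snd)

theorem ambIsotopic_rot (c : Circle) (A : Set V) : AmbIsotopic IV A (rot c '' A) := by
  obtain ⟨a, rfl⟩ := Circle.exp_surjective c
  refine ⟨fun t => rot (Circle.exp (t * a)), .of_inverse
    (G := fun t => rot (Circle.exp (t * -a))) ?_ (contMDiff_rot_exp a) (contMDiff_rot_exp (-a))
    ?_ ?_, by simp⟩
  · funext q; simp [rot]
  · intro t q; simp [rot]
  · intro t q; simp [rot]

theorem contMDiff_rot (c : Circle) : ContMDiff IV IV ∞ (rot c) :=
  (contMDiff_const.mul contMDiff_fst).prodMk contMDiff_snd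

theorem contMDiff_pcovN (m : ℕ) : ContMDiff IV IV ∞ (pcovN m) :=
  ((contMDiff_pow m).comp contMDiff_fst).prodMk contMDiff_snd

/-! ### Lifting maps to finite covers -/

/-- The map covering `(z, w) ↦ (z * exp (u (z, w)), s (z, w))` under `pcovN m`. -/
def coverMap (m : ℕ) (u : V → ℝ) (s : V → S3) : V → V :=
  fun q => (q.1 * Circle.exp (u (pcovN m q) / m), s (pcovN m q))

theorem pcovN_coverMap {m : ℕ} (hm : 1 ≤ m) {Φ : V → V} {u : V → ℝ}
    (h : ∀ q, (Φ q).1 = q.1 * Circle.exp (u q)) (q : V) :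
    pcovN m (coverMap m u (fun q => (Φ q).2) q) = Φ (pcovN m q) := by
  refine Prod.ext ?_ rfl
  have hm' : (m : ℝ) ≠ 0 := by positivity
  rw [h]
  simp only [pcovN, coverMap, mul_pow]
  rw [← Circle.exp_nsmul, nsmul_eq_mul, mul_div_cancel₀ _ hm']

theorem contMDiff_coverMap (m : ℕ) {u : ℝ → V → ℝ} {s : ℝ → V → S3}
    (hu : ContMDiff (𝓘(ℝ, ℝ).prod IV) 𝓘(ℝ, ℝ) ∞ (fun q : ℝ × V => u q.1 q.2))
    (hs : ContMDiff (𝓘(ℝ, ℝ).prod IV) (𝓡 3) ∞ (fun q : ℝ × V => s q.1 q.2)) :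
    ContMDiff (𝓘(ℝ, ℝ).prod IV) IV ∞ (fun q : ℝ × V => coverMap m (u q.1) (s q.1) q.2) := by
  have hp : ContMDiff (𝓘(ℝ, ℝ).prod IV) (𝓘(ℝ, ℝ).prod IV) ∞
      (fun q : ℝ × V => (q.1, pcovN m q.2)) :=
    contMDiff_fst.prodMk ((contMDiff_pcovN m).comp contMDiff_snd)
  have hu' : ContMDiff (𝓘(ℝ, ℝ).prod IV) 𝓘(ℝ, ℝ) ∞
      (fun q : ℝ × V => u q.1 (pcovN m q.2) / m) := (hu.comp hp).div_const _
  exact ((contMDiff_fst.comp contMDiff_snd).mul (contMDiff_circleExp.comp hu')).prodMk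
    (hs.comp hp)

theorem exists_smooth_cover {Φ : V → V} (hΦ : InDiff0 Φ) {n : ℕ} (hn : 1 ≤ n) :
    ∃ L : V → V, ContMDiff IV IV ∞ L ∧ ∀ q, pcovN n (L q) = Φ (pcovN n q) := by
  obtain ⟨⟨hs, -⟩, hc, ⟨K⟩⟩ := hΦ
  let g : C(V, Circle) := ⟨fun q => (Φ q).1 / q.1, by fun_prop⟩
  have hg : (ContinuousMap.const V 1).Homotopic g := by
    refine ⟨⟨⟨fun x => (K.symm x).1 / x.2.1, by fun_prop⟩, fun q => ?_, fun q => ?_⟩⟩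
    · simp
    · simp [g]
  obtain ⟨u, hu⟩ := exists_lift_circleExp hg
  have hus : ContMDiff IV 𝓘(ℝ, ℝ) ∞ u := by
    refine ContMDiff.of_circleExp u.continuous ?_
    simp only [hu]
    exact (contMDiff_fst.comp hs).div contMDiff_fst
  refine ⟨coverMap n u (fun q => (Φ q).2), ?_, pcovN_coverMap hn fun q => by simp [hu, g]⟩
  exact (contMDiff_coverMap n (u := fun _ => u) (s := fun _ q => (Φ q).2)
    (hus.comp contMDiff_snd) (contMDiff_snd.comp (hs.comp contMDiff_snd))).comp
    ((contMDiff_const (c := (0 : ℝ))).prodMk contMDiff_id)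

theorem InDiff0.exists_inverse {φ : V → V} (hφ : InDiff0 φ) :
    ∃ ψ : V → V, InDiff0 ψ ∧ Function.LeftInverse ψ φ ∧ Function.RightInverse ψ φ := by
  obtain ⟨⟨hs, g, hgs, hl, hr⟩, hc, hH⟩ := hφ
  refine ⟨g, ⟨⟨hgs, φ, hs, hr, hl⟩, hgs.continuous, ?_⟩, hl, hr⟩
  have h := (hH.comp (.refl (⟨g, hgs.continuous⟩ : C(V, V))))
  have h1 : (⟨φ, hc⟩ : C(V, V)).comp ⟨g, hgs.continuous⟩ = .id V := ContinuousMap.ext hr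
  rw [h1] at h
  exact h.symm

theorem InDiff0.exists_lift {φ : V → V} (hφ : InDiff0 φ) {n : ℕ} (hn : 1 ≤ n) :
    ∃ L, IsLiftN n φ L := by
  obtain ⟨ψ, hψ, hl, hr⟩ := hφ.exists_inverse
  obtain ⟨L, hL, hLc⟩ := exists_smooth_cover hφ hn
  obtain ⟨K, hK, hKc⟩ := exists_smooth_cover hψ hn
  obtain ⟨c, -, -, hc⟩ := eq_rot_of_pcovN_eq hn (hK.continuous.comp hL.continuous) continuous_id
    (fun q => by simp [hKc, hLc, hl _]) (Classical.arbitrary V)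
  obtain ⟨d, -, -, hd⟩ := eq_rot_of_pcovN_eq hn (hL.continuous.comp hK.continuous) continuous_id
    (fun q => by simp [hKc, hLc, hr _]) (Classical.arbitrary V)
  have hleft : Function.LeftInverse (fun q => rot c⁻¹ (K q)) L := fun q => by
    have := hc q
    simp only [Function.comp_apply, id_eq] at this
    simp [this, rot]
  have hsurj : Function.Surjective L := fun q => ⟨K (rot d⁻¹ q), by
    have := hd (rot d⁻¹ q)
    simp only [Function.comp_apply, id_eq] at this
    rw [this]
    simp [rot]⟩
  exact ⟨L, ⟨hL, _, (contMDiff_rot _).comp hK, hleft, hleft.rightInverse_of_surjective hsurj⟩, hLc⟩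

theorem exists_cover_family {F : ℝ → V → V} (h0 : F 0 = id)
    (hF : ContMDiff (𝓘(ℝ, ℝ).prod IV) IV ∞ (fun q : ℝ × V => F q.1 q.2)) {m : ℕ} (hm : 1 ≤ m) :
    ∃ L : ℝ → V → V, L 0 = id ∧
      ContMDiff (𝓘(ℝ, ℝ).prod IV) IV ∞ (fun q : ℝ × V => L q.1 q.2) ∧
      ∀ t q, pcovN m (L t q) = F t (pcovN m q) := by
  have hFc : Continuous (fun q : ℝ × V => F q.1 q.2) := hF.continuous
  let g : C(ℝ × V, Circle) := ⟨fun x => (F x.1 x.2).1 / x.2.1, by fun_prop⟩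
  have hg : (ContinuousMap.const (ℝ × V) 1).Homotopic g := by
    refine ⟨⟨⟨fun x => g ((x.1 : ℝ) * x.2.1, x.2.2), by fun_prop⟩, fun q => ?_, fun q => ?_⟩⟩
    · simp [g, h0]
    · simp
  obtain ⟨v, hv⟩ := exists_lift_circleExp hg
  have hvs : ContMDiff (𝓘(ℝ, ℝ).prod IV) 𝓘(ℝ, ℝ) ∞ v := by
    refine ContMDiff.of_circleExp v.continuous ?_
    simp only [hv]
    exact (contMDiff_fst.comp hF).div (contMDiff_fst.comp contMDiff_snd)
  let u : ℝ → V → ℝ := fun t q => v (t, q) - v (0, q)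
  have hus : ContMDiff (𝓘(ℝ, ℝ).prod IV) 𝓘(ℝ, ℝ) ∞ (fun q : ℝ × V => u q.1 q.2) :=
    hvs.sub (hvs.comp (contMDiff_const.prodMk contMDiff_snd))
  have hu : ∀ t q, (F t q).1 = q.1 * Circle.exp (u t q) := fun t q => by
    simp [u, Circle.exp_sub, hv, g, h0]
  refine ⟨fun t => coverMap m (u t) (fun q => (F t q).2), ?_,
    contMDiff_coverMap m (s := fun t q => (F t q).2) hus (contMDiff_snd.comp hF),
    fun t => pcovN_coverMap hm (hu t)⟩
  funext q
  simp [coverMap, u, h0, pcovN]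

theorem eq_of_cover_family {m : ℕ} (hm : 1 ≤ m) {L : ℝ → V → V} (h0 : L 0 = id)
    (hL : Continuous (fun q : ℝ × V => L q.1 q.2)) (h : ∀ t q, pcovN m (L t q) = pcovN m q)
    (t : ℝ) (q : V) : L t q = q := by
  obtain ⟨c, -, hc, hrot⟩ := eq_rot_of_pcovN_eq hm (f := fun t => L t q) (g := fun _ => q)
    (hL.comp (by fun_prop : Continuous fun t : ℝ => (t, q))) continuous_const (fun t => h t q) 0
  rw [hrot t, hc, h0]
  simp [rot]

/-- Ambient isotopies of `V` lift to finite covers. -/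
theorem IsAmbientIsotopy.exists_lift {F : ℝ → V → V} (hF : IsAmbientIsotopy IV F) {m : ℕ}
    (hm : 1 ≤ m) : ∃ L : ℝ → V → V, IsAmbientIsotopy IV L ∧
      ∀ t q, pcovN m (L t q) = F t (pcovN m q) := by
  obtain ⟨h0, -, hFs, G, hFG, hGs⟩ := hF
  have hG0 : G 0 = id := funext fun q => by simpa [h0] using (hFG 0).1 q
  obtain ⟨L, hL0, hLs, hL⟩ := exists_cover_family h0 hFs hm
  obtain ⟨K, hK0, hKs, hK⟩ := exists_cover_family hG0 hGs hm
  refine ⟨L, .of_inverse hL0 hLs hKs (eq_of_cover_family hm (L := fun t q => K t (L t q)) ?_ ?_ ?_)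
    (eq_of_cover_family hm (L := fun t q => L t (K t q)) ?_ ?_ ?_), hL⟩
  · simp [hL0, hK0]; rfl
  · exact (hKs.comp (contMDiff_fst.prodMk hLs)).continuous
  · intro t q; rw [hK, hL, (hFG t).1]
  · simp [hL0, hK0]; rfl
  · exact (hLs.comp (contMDiff_fst.prodMk hKs)).continuous
  · intro t q; rw [hL, hK, (hFG t).2]

/-! ### Independence of the lift and of the slice -/

theorem AmbIsotopic.image_slice {f : V → V} (hf : IsDiffeoB IV IV f) (z z₁ : Circle) :
    AmbIsotopic IV (f '' slice z) (f '' slice z₁) := by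
  have h := (ambIsotopic_rot (z₁ / z) (slice z)).image hf
  rwa [rot_image_slice, div_mul_cancel] at h

theorem IsLiftN.ambIsotopic {n : ℕ} (hn : 1 ≤ n) {φ a b : V → V} (ha : IsLiftN n φ a)
    (hb : IsLiftN n φ b) (z z₁ : Circle) : AmbIsotopic IV (a '' slice z) (b '' slice z₁) := by
  refine (AmbIsotopic.image_slice ha.1 z z₁).trans ?_
  obtain ⟨c, -, -, hc⟩ := eq_rot_of_pcovN_eq hn hb.1.1.continuous ha.1.1.continuous
    (fun q => by rw [ha.2, hb.2]) (Classical.arbitrary V)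
  have h := ambIsotopic_rot c (a '' slice z₁)
  rwa [image_image, ← funext hc] at h

/-- A self-map of `V` preserving the preimage of a slice under `pcovN m` maps each of its
components into a component. -/
theorem exists_mapsTo_slice {m : ℕ} (hm : 1 ≤ m) {h : V → V} (hc : Continuous h) {z₀ ζ : Circle}
    (hh : ∀ q : V, q.1 ^ m = z₀ → (h q).1 ^ m = z₀) (hζ : ζ ^ m = z₀) :
    ∃ ζ', ζ' ^ m = z₀ ∧ MapsTo h (slice ζ) (slice ζ') := by
  let w₀ : S3 := Classical.arbitrary S3
  refine ⟨(h (ζ, w₀)).1, hh _ hζ, ?_⟩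
  rintro ⟨z, w⟩ ⟨hz, -⟩
  obtain rfl : z = ζ := hz
  have := eq_of_pow_eq_one hm (c := fun w => (h (z, w)).1 / z) (by fun_prop)
    (fun w => by rw [div_pow, hh _ hζ, hζ, div_self']) w w₀
  exact ⟨div_left_injective this, mem_univ _⟩

/-- An ambient isotopy between slice images lifts to finite covers. -/
theorem ambIsotopic_of_pcovN {m : ℕ} (hm : 1 ≤ m) {φ ψ a b : V → V} (hφ : IsDiffeoB IV IV φ)
    (hψ : IsDiffeoB IV IV ψ) (ha : IsLiftN m φ a) (hb : IsLiftN m ψ b) {z₀ : Circle}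
    (h : AmbIsotopic IV (φ '' slice z₀) (ψ '' slice z₀)) (z z₁ : Circle) :
    AmbIsotopic IV (a '' slice z) (b '' slice z₁) := by
  obtain ⟨F, hF, hFz⟩ := h
  obtain ⟨L, hL, hLF⟩ := hF.exists_lift hm
  obtain ⟨ζ, hζ⟩ := exists_circle_pow_eq hm z₀
  have ⟨_, hbij, _⟩ := hF
  have ⟨_, _, hLs, K, hLK, hKs⟩ := hL
  have ⟨has, ai, hais, hai, hai'⟩ := ha.1
  have ⟨hbs, bi, hbis, hbi, hbi'⟩ := hb.1
  have hL1 : ContMDiff IV IV ∞ (L 1) := hLs.comp (contMDiff_const.prodMk contMDiff_id)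
  have hK1 : ContMDiff IV IV ∞ (K 1) := hKs.comp (contMDiff_const.prodMk contMDiff_id)
  let k : V → V := fun q => bi (L 1 (a q))
  let ki : V → V := fun q => ai (K 1 (b q))
  have hkki : ∀ q, k (ki q) = q := fun q => by
    simp only [k, ki]; rw [hai', (hLK 1).2, hbi]
  have hkik : ∀ q, ki (k q) = q := fun q => by
    simp only [k, ki]; rw [hbi', (hLK 1).1, hai]
  have hkc : Continuous k := (hbis.comp (hL1.comp has)).continuous
  have hkic : Continuous ki := (hais.comp (hK1.comp hbs)).continuous
  have hproj : ∀ q, ψ (pcovN m (k q)) = F 1 (φ (pcovN m q)) := fun q => by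
    rw [← hb.2, hbi', hLF, ha.2]
  have hψi : Function.Injective ψ := by
    obtain ⟨-, g, -, hg, -⟩ := hψ; exact hg.injective
  have hφi : Function.Injective φ := by
    obtain ⟨-, g, -, hg, -⟩ := hφ; exact hg.injective
  have hiff : ∀ q : V, q.1 ^ m = z₀ ↔ (k q).1 ^ m = z₀ := by
    intro q
    have hmem : ∀ p : V, p.1 ^ m = z₀ ↔ pcovN m p ∈ slice z₀ := fun p => by simp [pcovN]
    rw [hmem, hmem, ← hψi.mem_set_image (a := pcovN m (k q)), ← hFz, hproj, (hbij 1).1.mem_set_image,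
      hφi.mem_set_image]
  obtain ⟨ζ₁, hζ₁, hmaps⟩ := exists_mapsTo_slice hm hkc (fun q => (hiff q).1) hζ
  obtain ⟨ζ₂, hζ₂, hmaps'⟩ := exists_mapsTo_slice hm hkic
    (fun q hq => (hiff _).2 (by rwa [hkki])) hζ₁
  obtain rfl : ζ = ζ₂ := by
    have := hmaps' (hmaps (show (ζ, Classical.arbitrary S3) ∈ slice ζ by simp))
    rw [hkik] at this
    exact this.1
  have himg : k '' slice ζ = slice ζ₁ :=
    hmaps.image_subset.antisymm fun q hq => ⟨ki q, hmaps' hq, hkki q⟩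
  have hiso : AmbIsotopic IV (a '' slice ζ) (b '' slice ζ₁) :=
    ⟨L, hL, by rw [← himg, image_image, image_image]; simp only [k, hbi' _]⟩
  exact (AmbIsotopic.image_slice ha.1 z ζ).trans (hiso.trans (AmbIsotopic.image_slice hb.1 ζ₁ z₁))

/-- S-equivalence detected at level `n` is detected by all lifts at every multiple of `n`. -/
theorem ambIsotopic_of_mul {n m : ℕ} (hn : 1 ≤ n) (hm : 1 ≤ m) {φ ψ φh ψh a b : V → V}
    (hφ : IsLiftN n φ φh) (hψ : IsLiftN n ψ ψh) {z₀ : Circle}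
    (h : AmbIsotopic IV (φh '' slice z₀) (ψh '' slice z₀)) (ha : IsLiftN (n * m) φ a)
    (hb : IsLiftN (n * m) ψ b) (z z₁ : Circle) :
    AmbIsotopic IV (a '' slice z) (b '' slice z₁) := by
  have key : ∀ {φ φh a : V → V}, IsLiftN n φ φh → IsLiftN (n * m) φ a →
      ∃ φ', IsLiftN n φ φ' ∧ IsLiftN m φ' a := by
    intro φ φh a hφ ha
    obtain ⟨c, hcn, -, hc⟩ := eq_rot_of_pcovN_eq hn
      ((contMDiff_pcovN m).comp ha.1.1).continuous (hφ.1.1.comp (contMDiff_pcovN m)).continuous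
      (fun q => by simp only [Function.comp_apply]; rw [pcovN_pcovN, ha.2, hφ.2, pcovN_pcovN])
      (Classical.arbitrary V)
    obtain ⟨⟨hs, g, hgs, hl, hr⟩, hcov⟩ := hφ
    refine ⟨fun q => rot c (φh q), ⟨⟨(contMDiff_rot c).comp hs, fun q => g (rot c⁻¹ q),
      hgs.comp (contMDiff_rot _), fun q => ?_, fun q => ?_⟩, fun q => ?_⟩, ha.1, hc⟩
    · simpa [rot] using hl q
    · simp [hr _, rot]
    · rw [pcovN_rot hcn, hcov]
  obtain ⟨φ', hφ', ha'⟩ := key hφ ha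
  obtain ⟨ψ', hψ', hb'⟩ := key hψ hb
  exact ambIsotopic_of_pcovN hm hφ'.1 hψ'.1 ha' hb'
    ((hφ'.ambIsotopic hn hφ z₀ z₀).trans (h.trans (hψ.ambIsotopic hn hψ' z₀ z₀))) z z₁

/-- S-equivalence is an equivalence relation on `Diff₀(V)`. -/
theorem sequiv_is_equivalence :
    (∀ φ : V → V, InDiff0 φ → SEquiv φ φ) ∧
    (∀ φ ψ : V → V, InDiff0 φ → InDiff0 ψ → SEquiv φ ψ → SEquiv ψ φ) ∧
    (∀ φ ψ χ : V → V, InDiff0 φ → InDiff0 ψ → InDiff0 χ →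
      SEquiv φ ψ → SEquiv ψ χ → SEquiv φ χ) := by
  refine ⟨fun φ hφ => ?_, fun φ ψ _ _ => ?_, fun φ ψ χ hφ hψ hχ => ?_⟩
  · have h : IsLiftN 1 φ φ := ⟨hφ.1, fun q => by simp only [pcovN_one]⟩
    exact ⟨1, le_rfl, φ, φ, h, h, 1, .refl _⟩
  · rintro ⟨n, hn, a, b, ha, hb, z, h⟩
    exact ⟨n, hn, b, a, hb, ha, z, h.symm⟩
  · rintro ⟨n, hn, φ₁, ψ₁, hφ₁, hψ₁, z₁, h₁⟩ ⟨m, hm, ψ₂, χ₂, hψ₂, hχ₂, z₂, h₂⟩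
    have hnm : 1 ≤ n * m := Nat.mul_pos hn hm
    obtain ⟨a, ha⟩ := hφ.exists_lift hnm
    obtain ⟨b, hb⟩ := hψ.exists_lift hnm
    obtain ⟨c, hc⟩ := hχ.exists_lift hnm
    refine ⟨n * m, hnm, a, c, ha, hc, 1, (ambIsotopic_of_mul hn hm hφ₁ hψ₁ h₁ ha hb 1 1).trans ?_⟩
    rw [mul_comm] at hb hc
    exact ambIsotopic_of_mul hm hn hψ₂ hχ₂ h₂ hb hc 1 1

end
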